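/- Let L be a Lagrangian subspace of V = ℝ^{2n_A} × ℝ^{2n_B} with the product symplectic form. Then dim L − dim L_A − dim L_B is an even natural number (the correlated generators of a continuous-variable stabilizer state come in pairs). -/

import Mathlib

open scoped BigOperators

namespace EntTrim

/-- The standard symplectic form on `ℝ^(2m)`:
`σ(v, w) = Σ_{i=1}^m (v_{2i-1} * w_{2i} - v_{2i} * w_{2i-1})` (zero-based indexing). -/
def stdSymp (m : ℕ) (v w : Fin (2 * m) → ℝ) : ℝ :=
  ∑ i : Fin m,
    (v ⟨2 * (i : ℕ), by have := i.isLt; omega⟩ *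
        w ⟨2 * (i : ℕ) + 1, by have := i.isLt; omega⟩ -
      v ⟨2 * (i : ℕ) + 1, by have := i.isLt; omega⟩ *
        w ⟨2 * (i : ℕ), by have := i.isLt; omega⟩)

/-- The product symplectic form on `ℝ^(2nA) × ℝ^(2nB)`:
`σ((u_A,u_B),(w_A,w_B)) = σ_A(u_A,w_A) + σ_B(u_B,w_B)`. -/
def prodSymp (nA nB : ℕ) (u w : (Fin (2 * nA) → ℝ) × (Fin (2 * nB) → ℝ)) : ℝ :=
  stdSymp nA u.1 w.1 + stdSymp nB u.2 w.2

/-- An alternating bilinear form over a field of characteristic different from two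
has even rank. -/
theorem even_finrank_range_of_isAlt {K V : Type*} [Field K] [NeZero (2 : K)] [AddCommGroup V]
    [Module K V] [FiniteDimensional K V] {B : LinearMap.BilinForm K V} (hB : B.IsAlt) :
    Even (Module.finrank K (LinearMap.range B)) := by
  classical
  obtain ⟨C, hC⟩ := (LinearMap.ker B).exists_isCompl
  have hrank : Module.finrank K (LinearMap.range B) = Module.finrank K C := by
    have h₁ := LinearMap.finrank_range_add_finrank_ker B
    have h₂ := Submodule.finrank_add_eq_of_isCompl hC
    omega
  have hsep : (B.restrict C).SeparatingLeft := by
    intro x hx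
    have hker : (x : V) ∈ LinearMap.ker B := by
      rw [LinearMap.mem_ker]
      ext y
      obtain ⟨r, hr, c, hc, rfl⟩ := Submodule.mem_sup.mp
        (hC.sup_eq_top ▸ Submodule.mem_top : y ∈ LinearMap.ker B ⊔ C)
      have hxr : B x r = 0 := by
        rw [← LinearMap.IsAlt.neg hB, LinearMap.mem_ker.mp hr, LinearMap.zero_apply, neg_zero]
      have hxc : B x c = 0 := hx ⟨c, hc⟩
      simp [hxr, hxc]
    exact Subtype.ext ((Submodule.disjoint_def.mp hC.disjoint) x hker x.2)
  let b := Module.finBasis K C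
  have hdet : (LinearMap.toMatrix₂ b b (B.restrict C)).det ≠ 0 :=
    (LinearMap.separatingLeft_iff_det_ne_zero b).mp hsep
  have hskew : (LinearMap.toMatrix₂ b b (B.restrict C)).transpose =
      -LinearMap.toMatrix₂ b b (B.restrict C) := by
    ext i j
    simp only [Matrix.transpose_apply, Matrix.neg_apply, LinearMap.toMatrix₂_apply]
    exact (LinearMap.IsAlt.neg hB _ _).symm
  rw [hrank]
  by_contra hodd
  rw [Nat.not_even_iff_odd] at hodd
  have h := Matrix.det_transpose (LinearMap.toMatrix₂ b b (B.restrict C))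
  rw [hskew, Matrix.det_neg, Fintype.card_fin, hodd.neg_one_pow, neg_one_mul,
    neg_eq_iff_add_eq_zero, ← two_mul] at h
  exact (mul_ne_zero two_ne_zero hdet) h

/-- The orthogonal direct sum of two bilinear forms. -/
def prodForm {K V W : Type*} [Field K] [AddCommGroup V] [Module K V] [AddCommGroup W] [Module K W]
    (A : LinearMap.BilinForm K V) (B : LinearMap.BilinForm K W) :
    LinearMap.BilinForm K (V × W) :=
  A.compl₁₂ (LinearMap.fst K V W) (LinearMap.fst K V W) +
    B.compl₁₂ (LinearMap.snd K V W) (LinearMap.snd K V W)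

@[simp]
theorem prodForm_apply {K V W : Type*} [Field K] [AddCommGroup V] [Module K V] [AddCommGroup W]
    [Module K W] (A : LinearMap.BilinForm K V) (B : LinearMap.BilinForm K W) (u w : V × W) :
    prodForm A B u w = A u.1 w.1 + B u.2 w.2 :=
  rfl

theorem isAlt_prodForm {K V W : Type*} [Field K] [AddCommGroup V] [Module K V] [AddCommGroup W]
    [Module K W] {A : LinearMap.BilinForm K V} {B : LinearMap.BilinForm K W}
    (hA : A.IsAlt) (hB : B.IsAlt) : (prodForm A B).IsAlt := fun u => by
  simp [hA.self_eq_zero, hB.self_eq_zero]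

theorem separatingLeft_prodForm {K V W : Type*} [Field K] [AddCommGroup V] [Module K V]
    [AddCommGroup W] [Module K W] {A : LinearMap.BilinForm K V} {B : LinearMap.BilinForm K W}
    (hA : A.SeparatingLeft) (hB : B.SeparatingLeft) : (prodForm A B).SeparatingLeft := fun u hu =>
  Prod.ext (hA _ fun v => by simpa using hu (v, 0)) (hB _ fun w => by simpa using hu (0, w))

/-- A totally isotropic subspace of half the dimension is its own orthogonal complement. -/
theorem orthogonal_eq_self_of_isotropic {K V : Type*} [Field K] [AddCommGroup V] [Module K V]
    [FiniteDimensional K V] {B : LinearMap.BilinForm K V} (hB : B.Nondegenerate)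
    {L : Submodule K V} (hiso : ∀ u ∈ L, ∀ w ∈ L, B u w = 0)
    (hdim : Module.finrank K V = 2 * Module.finrank K L) : B.orthogonal L = L := by
  refine (Submodule.eq_of_le_of_finrank_le (fun w hw => ?_) ?_).symm
  · exact LinearMap.BilinForm.mem_orthogonal_iff.mpr fun u hu => hiso u hu w hw
  · rw [LinearMap.BilinForm.finrank_orthogonal hB]
    omega

/-- For a Lagrangian subspace `L` of an orthogonal direct sum of two symplectic spaces,
the dimension of `L` exceeds those of its two local parts by an even number. -/
theorem even_correlated_dimension_of_lagrangian {K V W : Type*} [Field K] [NeZero (2 : K)]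
    [AddCommGroup V] [Module K V] [FiniteDimensional K V]
    [AddCommGroup W] [Module K W] [FiniteDimensional K W]
    {A : LinearMap.BilinForm K V} {B : LinearMap.BilinForm K W}
    (hA : A.IsAlt) (hB : B.IsAlt) (hA' : A.SeparatingLeft) (hB' : B.SeparatingLeft)
    {L : Submodule K (V × W)} (hiso : ∀ u ∈ L, ∀ w ∈ L, prodForm A B u w = 0)
    (hdim : Module.finrank K (V × W) = 2 * Module.finrank K L) :
    ∃ E : ℕ, Module.finrank K L =
      Module.finrank K (L.comap (LinearMap.inl K V W)) +
        Module.finrank K (L.comap (LinearMap.inr K V W)) + 2 * E := by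
  have halt := isAlt_prodForm hA hB
  have horth := orthogonal_eq_self_of_isotropic
    (halt.isRefl.nondegenerate_iff_separatingLeft.mpr (separatingLeft_prodForm hA' hB')) hiso hdim
  have hmem : ∀ u : V × W, (∀ w ∈ L, prodForm A B u w = 0) → u ∈ L := fun u hu => by
    rw [← horth, LinearMap.BilinForm.mem_orthogonal_iff]
    exact fun w hw => halt.isRefl _ _ (hu w hw)
  let ω : LinearMap.BilinForm K L :=
    A.compl₁₂ (LinearMap.fst K V W ∘ₗ L.subtype) (LinearMap.fst K V W ∘ₗ L.subtype)
  have hω : ω.IsAlt := fun u => hA.self_eq_zero _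
  let ι : (L.comap (LinearMap.inl K V W) × L.comap (LinearMap.inr K V W)) →ₗ[K] L :=
    LinearMap.codRestrict L
      ((L.comap (LinearMap.inl K V W)).subtype.prodMap (L.comap (LinearMap.inr K V W)).subtype)
      fun p => by
        have h := L.add_mem p.1.2 p.2.2
        simpa using h
  have hι : Function.Injective ι := fun p q hpq => by
    have h := congrArg Subtype.val hpq
    exact Prod.ext (Subtype.ext (congrArg Prod.fst h)) (Subtype.ext (congrArg Prod.snd h))
  have hrange : LinearMap.range ι = LinearMap.ker ω := by
    apply le_antisymm
    · rintro _ ⟨p, rfl⟩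
      rw [LinearMap.mem_ker]
      ext w
      have h : prodForm A B ((p.1 : V), 0) w = 0 := hiso _ p.1.2 _ w.2
      rwa [prodForm_apply, map_zero, LinearMap.zero_apply, add_zero] at h
    · intro u hu
      have hu' : ∀ w ∈ L, A (u : V × W).1 w.1 = 0 := fun w hw =>
        LinearMap.congr_fun (LinearMap.mem_ker.mp hu) ⟨w, hw⟩
      have h₁ : ((u : V × W).1, (0 : W)) ∈ L := hmem _ fun w hw => by simpa using hu' w hw
      have h₂ : ((0 : V), (u : V × W).2) ∈ L := by
        convert! L.sub_mem u.2 h₁ using 1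
        ext <;> simp
      exact ⟨(⟨_, h₁⟩, ⟨_, h₂⟩), rfl⟩
  obtain ⟨E, hE⟩ := even_finrank_range_of_isAlt hω
  refine ⟨E, ?_⟩
  have hker := LinearMap.finrank_range_of_inj hι
  rw [hrange, Module.finrank_prod] at hker
  have hrank := LinearMap.finrank_range_add_finrank_ker ω
  omega

/-- The standard symplectic form as a bilinear form. -/
def stdSympForm (m : ℕ) : LinearMap.BilinForm ℝ (Fin (2 * m) → ℝ) :=
  LinearMap.mk₂ ℝ (stdSymp m)
    (fun u v w => by
      simp only [stdSymp, Pi.add_apply, ← Finset.sum_add_distrib]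
      exact Finset.sum_congr rfl fun i _ => by ring)
    (fun c v w => by
      simp only [stdSymp, Pi.smul_apply, smul_eq_mul, Finset.mul_sum]
      exact Finset.sum_congr rfl fun i _ => by ring)
    (fun u v w => by
      simp only [stdSymp, Pi.add_apply, ← Finset.sum_add_distrib]
      exact Finset.sum_congr rfl fun i _ => by ring)
    (fun c v w => by
      simp only [stdSymp, Pi.smul_apply, smul_eq_mul, Finset.mul_sum]
      exact Finset.sum_congr rfl fun i _ => by ring)

theorem isAlt_stdSympForm (m : ℕ) : (stdSympForm m).IsAlt := fun v => by
  change stdSymp m v v = 0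
  exact Finset.sum_eq_zero fun i _ => by ring

theorem separatingLeft_stdSympForm (m : ℕ) : (stdSympForm m).SeparatingLeft := by
  intro v hv
  ext ⟨j, hj⟩
  obtain ⟨i, rfl | rfl⟩ := Nat.even_or_odd' j
  · have h : stdSymp m v (Pi.single ⟨2 * i + 1, by omega⟩ 1) = 0 := hv _
    rw [stdSymp, Finset.sum_eq_single ⟨i, by omega⟩] at h
    · simpa [Pi.single_apply] using h
    · intro k _ hk
      have hk' : (k : ℕ) ≠ i := fun e => hk (Fin.ext e)
      have h' : 2 * (k : ℕ) ≠ 2 * i + 1 := by omega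
      simp [hk', h']
    · simp
  · have h : stdSymp m v (Pi.single ⟨2 * i, by omega⟩ 1) = 0 := hv _
    rw [stdSymp, Finset.sum_eq_single ⟨i, by omega⟩] at h
    · simpa [Pi.single_apply] using h
    · intro k _ hk
      have hk' : (k : ℕ) ≠ i := fun e => hk (Fin.ext e)
      have h' : 2 * (k : ℕ) + 1 ≠ 2 * i := by omega
      simp [hk', h']
    · simp

/-- For a Lagrangian subspace `L` of `ℝ^(2nA) × ℝ^(2nB)`,
`dim L − dim L_A − dim L_B` is even: the correlated generators come in pairs. -/
theorem correlated_dimension_even (nA nB : ℕ)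
    (L : Submodule ℝ ((Fin (2 * nA) → ℝ) × (Fin (2 * nB) → ℝ)))
    (hiso : ∀ u ∈ L, ∀ w ∈ L, prodSymp nA nB u w = 0)
    (hdim : Module.finrank ℝ L = nA + nB) :
    ∃ E : ℕ, Module.finrank ℝ L =
      Module.finrank ℝ
          (Submodule.comap (LinearMap.inl ℝ (Fin (2 * nA) → ℝ) (Fin (2 * nB) → ℝ)) L) +
        Module.finrank ℝ
          (Submodule.comap (LinearMap.inr ℝ (Fin (2 * nA) → ℝ) (Fin (2 * nB) → ℝ)) L) +
        2 * E := by
  refine even_correlated_dimension_of_lagrangian (isAlt_stdSympForm nA) (isAlt_stdSympForm nB)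
    (separatingLeft_stdSympForm nA) (separatingLeft_stdSympForm nB) hiso ?_
  rw [hdim, Module.finrank_prod, Module.finrank_fin_fun, Module.finrank_fin_fun]
  ring

end EntTrim
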